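/- arXiv:1006.4173 — 4 statements merged into one kernel-verified Lean document; each statement's English description precedes it below -/
import Mathlib

section
/- Let U be a finite set and let h1, h2 : U → [0,1) be random functions such that the family (h1(x))_{x∈U} is pairwise independent with each h1(x) uniformly distributed on [0,1), likewise for (h2(y))_{y∈U}, and the two families are independent of each other. Define h : U × U → [0,1) by h(x,y) = (h1(x) − h2(y)) mod 1. Then h is a pairwise independent hash function with uniform values: for any two distinct pairs (x,y) ≠ (x',y') in U × U, the random variables h(x,y) and h(x',y') are independent and each is uniformly distributed on [0,1). -/
open MeasureTheory ProbabilityTheory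

lemma measurePreserving_coe_unitAddCircle :
    MeasurePreserving (fun u : ℝ ↦ (u : UnitAddCircle)) (volume.restrict (Set.Ico (0 : ℝ) 1))
      volume := by
  have h := AddCircle.measurePreserving_mk (1 : ℝ) 0
  rwa [zero_add, ← Measure.restrict_congr_set (Ico_ae_eq_Ioc (μ := volume))] at h

/-- The uniform probability measure on `[0,1)` is the image of the Haar measure of the circle. -/
lemma measurePreserving_equivIco :
    MeasurePreserving (fun x : UnitAddCircle ↦ (AddCircle.equivIco 1 0 x : ℝ)) volume
      (volume.restrict (Set.Ico (0 : ℝ) 1)) := by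
  have hm : Measurable fun x : UnitAddCircle ↦ (AddCircle.equivIco 1 0 x : ℝ) :=
    measurable_subtype_coe.comp (AddCircle.measurableEquivIco (1 : ℝ) 0).measurable
  refine ⟨hm, ?_⟩
  rw [← measurePreserving_coe_unitAddCircle.map_eq, Measure.map_map hm measurePreserving_coe_unitAddCircle.measurable]
  conv_rhs => rw [← Measure.map_id (μ := volume.restrict (Set.Ico (0 : ℝ) 1))]
  refine Measure.map_congr ?_
  filter_upwards [ae_restrict_mem measurableSet_Ico] with u hu
  simp [AddCircle.coe_equivIco_mk_apply, Int.fract_eq_self.2 hu]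

/-- A measure preserving self-map of the circle induces one of `[0,1)` with the uniform measure. -/
lemma MeasureTheory.MeasurePreserving.of_unitAddCircle {g : UnitAddCircle → UnitAddCircle}
    (hg : MeasurePreserving g volume volume) {f : ℝ → ℝ}
    (hfg : ∀ u : ℝ, (AddCircle.equivIco 1 0 (g u) : ℝ) = f u) :
    MeasurePreserving f (volume.restrict (Set.Ico (0 : ℝ) 1))
      (volume.restrict (Set.Ico (0 : ℝ) 1)) := by
  rw [← funext hfg]
  exact measurePreserving_equivIco.comp (hg.comp measurePreserving_coe_unitAddCircle)

lemma measurePreserving_fract_sub_right (c : ℝ) :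
    MeasurePreserving (fun u : ℝ ↦ Int.fract (u - c)) (volume.restrict (Set.Ico (0 : ℝ) 1))
      (volume.restrict (Set.Ico (0 : ℝ) 1)) :=
  (measurePreserving_sub_right volume (c : UnitAddCircle)).of_unitAddCircle fun u ↦ by
    rw [← AddCircle.coe_sub, AddCircle.coe_equivIco_mk_apply, div_one, mul_one]

lemma measurePreserving_fract_sub_left (c : ℝ) :
    MeasurePreserving (fun u : ℝ ↦ Int.fract (c - u)) (volume.restrict (Set.Ico (0 : ℝ) 1))
      (volume.restrict (Set.Ico (0 : ℝ) 1)) :=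
  (Measure.measurePreserving_sub_left volume (c : UnitAddCircle)).of_unitAddCircle fun u ↦ by
    rw [← AddCircle.coe_sub, AddCircle.coe_equivIco_mk_apply, div_one, mul_one]

/-- If `A` and `B` are independent and every `g b` preserves the law `κ` of `A`, then `g B A` has
law `κ` too. -/
lemma ProbabilityTheory.IndepFun.map_eq_of_measurePreserving {Ω α β : Type*} [MeasurableSpace Ω]
    [MeasurableSpace α] [MeasurableSpace β] {μ : Measure Ω} [IsProbabilityMeasure μ]
    {κ : Measure α} {A : Ω → α} {B : Ω → β} (hAB : IndepFun A B μ) (hA : Measurable A)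
    (hB : Measurable B) (hκ : μ.map A = κ) {g : β → α → α} (hg : Measurable (Function.uncurry g))
    (hgκ : ∀ b, MeasurePreserving (g b) κ κ) :
    μ.map (fun ω ↦ g (B ω) (A ω)) = κ := by
  have : IsProbabilityMeasure κ := hκ ▸ Measure.isProbabilityMeasure_map hA.aemeasurable
  have : IsProbabilityMeasure (μ.map B) := Measure.isProbabilityMeasure_map hB.aemeasurable
  have hlaw : μ.map (fun ω ↦ (B ω, A ω)) = (μ.map B).prod κ := by
    rw [(indepFun_iff_map_prod_eq_prod_map_map hB.aemeasurable hA.aemeasurable).1 hAB.symm, hκ]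
  have hskew := (MeasurePreserving.id (μ.map B)).skew_product hg
    (Filter.Eventually.of_forall fun b ↦ (hgκ b).map_eq)
  have h := (measurePreserving_snd.comp hskew).map_eq
  rwa [← hlaw, Measure.map_map (by fun_prop) (by fun_prop)] at h

/-- If `h1, h2 : U → [0,1)` are random functions, each family pairwise independent
with uniform values on `[0,1)`, and the two families independent of each other,
then `h(x,y) = (h1 x - h2 y) mod 1` is a pairwise independent hash function with
values uniform on `[0,1)`. -/
theorem pairwise_independent_uniform_of_fract_sub
    {Ω U : Type*} [MeasurableSpace Ω] [Fintype U]
    (μ : Measure Ω) [IsProbabilityMeasure μ]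
    (h1 h2 : U → Ω → ℝ)
    (hm1 : ∀ x, Measurable (h1 x)) (hm2 : ∀ y, Measurable (h2 y))
    (hrange1 : ∀ x ω, h1 x ω ∈ Set.Ico (0 : ℝ) 1)
    (hrange2 : ∀ y ω, h2 y ω ∈ Set.Ico (0 : ℝ) 1)
    (hu1 : ∀ x, Measure.map (h1 x) μ = volume.restrict (Set.Ico (0 : ℝ) 1))
    (hu2 : ∀ y, Measure.map (h2 y) μ = volume.restrict (Set.Ico (0 : ℝ) 1))
    (hpi1 : Pairwise fun x x' => IndepFun (h1 x) (h1 x') μ)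
    (hpi2 : Pairwise fun y y' => IndepFun (h2 y) (h2 y') μ)
    (hind : IndepFun (fun ω x => h1 x ω) (fun ω y => h2 y ω) μ)
    (h : U × U → Ω → ℝ)
    (hdef : ∀ x y ω, h (x, y) ω = Int.fract (h1 x ω - h2 y ω)) :
    ∀ p p' : U × U, p ≠ p' →
      IndepFun (h p) (h p') μ ∧
      Measure.map (h p) μ = volume.restrict (Set.Ico (0 : ℝ) 1) := by
  have hm1' : Measurable fun ω x ↦ h1 x ω := measurable_pi_lambda _ hm1
  have hm2' : Measurable fun ω y ↦ h2 y ω := measurable_pi_lambda _ hm2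
  have hfun : ∀ p, h p = fun ω ↦ Int.fract (h1 p.1 ω - h2 p.2 ω) := fun p ↦ funext (hdef p.1 p.2)
  have hm : ∀ p, Measurable (h p) := fun p ↦ hfun p ▸ ((hm1 p.1).sub (hm2 p.2)).fract
  have hunif : ∀ p, μ.map (h p) = volume.restrict (Set.Ico (0 : ℝ) 1) := fun p ↦ by
    rw [hfun]
    exact (hind.comp (measurable_pi_apply p.1)
      (measurable_pi_apply p.2)).map_eq_of_measurePreserving (hm1 p.1) (hm2 p.2) (hu1 p.1)
      (g := fun b a ↦ Int.fract (a - b)) (measurable_snd.sub measurable_fst).fract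
      measurePreserving_fract_sub_right
  rintro ⟨x, y⟩ ⟨x', y'⟩ hne
  refine ⟨?_, hunif _⟩
  rw [indepFun_iff_map_prod_eq_prod_map_map (hm _).aemeasurable (hm _).aemeasurable, hunif, hunif,
    hfun, hfun]
  have hpair : IndepFun (fun ω ↦ (h1 x ω, h1 x' ω)) (fun ω ↦ (h2 y ω, h2 y' ω)) μ :=
    hind.comp (φ := fun f ↦ (f x, f x')) (ψ := fun f ↦ (f y, f y')) (by fun_prop) (by fun_prop)
  by_cases hx : x = x'
  · have hy : y ≠ y' := fun hy ↦ hne (by rw [hx, hy])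
    have hlaw := (indepFun_iff_map_prod_eq_prod_map_map (hm2 y).aemeasurable
      (hm2 y').aemeasurable).1 (hpi2 hy)
    rw [hu2, hu2] at hlaw
    exact hpair.symm.map_eq_of_measurePreserving ((hm2 y).prodMk (hm2 y'))
      ((hm1 x).prodMk (hm1 x')) hlaw
      (g := fun b a ↦ (Int.fract (b.1 - a.1), Int.fract (b.2 - a.2)))
      (by unfold Function.uncurry; fun_prop)
      fun b ↦ (measurePreserving_fract_sub_left b.1).prod (measurePreserving_fract_sub_left b.2)
  · have hlaw := (indepFun_iff_map_prod_eq_prod_map_map (hm1 x).aemeasurable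
      (hm1 x').aemeasurable).1 (hpi1 hx)
    rw [hu1, hu1] at hlaw
    exact hpair.map_eq_of_measurePreserving ((hm1 x).prodMk (hm1 x'))
      ((hm2 y).prodMk (hm2 y')) hlaw
      (g := fun b a ↦ (Int.fract (a.1 - b.1), Int.fract (a.2 - b.2)))
      (by unfold Function.uncurry; fun_prop)
      fun b ↦ (measurePreserving_fract_sub_right b.1).prod (measurePreserving_fract_sub_right b.2)
end

section
/- Let Q be a finite index set with |Q| = z ≥ 1 and let (U_q)_{q∈Q} be pairwise independent random variables, each uniformly distributed on [0,1]. Let ε ∈ (0, 1/4) and let k be a real number with k ≥ 9/ε² and k/((1+ε)z) ≤ 1. Then the probability that at least k of the variables U_q take a value smaller than k/((1+ε)z) is at most 1/6. -/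
open MeasureTheory ProbabilityTheory

/-- The variance of an indicator function is at most the probability of the underlying set. -/
lemma variance_indicator_one_le {Ω : Type*} [MeasurableSpace Ω] (μ : Measure Ω)
    [IsProbabilityMeasure μ] {s : Set Ω} (hs : MeasurableSet s) :
    variance (s.indicator fun _ => (1 : ℝ)) μ ≤ μ.real s := by
  have hmeas : Measurable (s.indicator fun _ => (1 : ℝ)) := measurable_const.indicator hs
  refine (variance_le_expectation_sq hmeas.aestronglyMeasurable).trans_eq ?_
  have hsq : (s.indicator fun _ => (1 : ℝ)) ^ 2 = s.indicator fun _ => (1 : ℝ) := by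
    ext ω
    by_cases hω : ω ∈ s <;> simp [hω]
  rw [hsq, integral_indicator_const _ hs]
  simp

/-- The probability that a uniform variable on `[0,1]` is smaller than `t ∈ [0,1]` is `t`. -/
lemma measureReal_preimage_Iio_of_map_eq_uniform {Ω : Type*} [MeasurableSpace Ω] {μ : Measure Ω}
    {U : Ω → ℝ} (hmeas : Measurable U)
    (hunif : Measure.map U μ = volume.restrict (Set.Icc (0 : ℝ) 1))
    {t : ℝ} (ht0 : 0 ≤ t) (ht1 : t ≤ 1) : μ.real (U ⁻¹' Set.Iio t) = t := by
  have hset : Set.Iio t ∩ Set.Icc (0 : ℝ) 1 = Set.Ico 0 t := by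
    ext x
    simp only [Set.mem_inter_iff, Set.mem_Iio, Set.mem_Icc, Set.mem_Ico]
    grind
  rw [measureReal_def, ← Measure.map_apply hmeas measurableSet_Iio, hunif,
    Measure.restrict_apply measurableSet_Iio, hset, Real.volume_Ico, sub_zero,
    ENNReal.toReal_ofReal ht0]

/-- Chebyshev's upper tail bound for the number of pairwise independent uniform variables that are
smaller than `t`. -/
lemma prob_le_card_uniform_lt_le {Ω Q : Type*} [MeasurableSpace Ω] [Fintype Q]
    (μ : Measure Ω) [IsProbabilityMeasure μ]
    (U : Q → Ω → ℝ) (hmeas : ∀ q, Measurable (U q))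
    (hunif : ∀ q, Measure.map (U q) μ = volume.restrict (Set.Icc (0 : ℝ) 1))
    (hpi : Pairwise fun q q' => IndepFun (U q) (U q') μ)
    {t k : ℝ} (ht0 : 0 ≤ t) (ht1 : t ≤ 1) (hk : Fintype.card Q * t < k) :
    μ {ω | k ≤ (Nat.card {q : Q // U q ω < t} : ℝ)} ≤
      ENNReal.ofReal (Fintype.card Q * t / (k - Fintype.card Q * t) ^ 2) := by
  classical
  let X : Q → Ω → ℝ := fun q => (U q ⁻¹' Set.Iio t).indicator fun _ => 1
  have hs : ∀ q, MeasurableSet (U q ⁻¹' Set.Iio t) := fun q => hmeas q measurableSet_Iio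
  have hX : ∀ q, MemLp (X q) 2 μ := fun q =>
    memLp_indicator_const 2 (hs q) 1 (Or.inr (measure_ne_top _ _))
  have hprob : ∀ q, μ.real (U q ⁻¹' Set.Iio t) = t := fun q =>
    measureReal_preimage_Iio_of_map_eq_uniform (hmeas q) (hunif q) ht0 ht1
  have hmean : ∫ ω, (∑ q, X q) ω ∂μ = Fintype.card Q * t := by
    simp only [Finset.sum_apply]
    rw [integral_finsetSum _ fun q _ => (hX q).integrable one_le_two]
    simp [X, integral_indicator_const _ (hs _), hprob]
  have hindep : Pairwise fun q q' => IndepFun (X q) (X q') μ := fun q q' hqq' =>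
    (hpi hqq').comp (φ := (Set.Iio t).indicator fun _ => (1 : ℝ))
      (ψ := (Set.Iio t).indicator fun _ => (1 : ℝ))
      (measurable_const.indicator measurableSet_Iio) (measurable_const.indicator measurableSet_Iio)
  have hvar : variance (∑ q, X q) μ ≤ Fintype.card Q * t := by
    rw [IndepFun.variance_sum (fun q _ => hX q) fun q _ q' _ hqq' => hindep hqq']
    calc ∑ q, variance (X q) μ ≤ ∑ _q : Q, t :=
          Finset.sum_le_sum fun q _ => (variance_indicator_one_le μ (hs q)).trans_eq (hprob q)
      _ = Fintype.card Q * t := by simp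
  have hcount : ∀ ω, (Nat.card {q : Q // U q ω < t} : ℝ) = (∑ q, X q) ω := fun ω => by
    simp [X, Set.indicator_apply, Fintype.card_subtype]
  have hsum : MemLp (∑ q, X q) 2 μ := memLp_finsetSum' _ fun q _ => hX q
  calc μ {ω | k ≤ (Nat.card {q : Q // U q ω < t} : ℝ)}
      ≤ μ {ω | k - Fintype.card Q * t ≤ |(∑ q, X q) ω - ∫ ω, (∑ q, X q) ω ∂μ|} := by
        refine measure_mono fun ω hω => ?_
        rw [Set.mem_ofPred_eq, hcount] at hω
        rw [Set.mem_ofPred_eq, hmean]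
        exact (sub_le_sub_right hω _).trans (le_abs_self _)
    _ ≤ ENNReal.ofReal (variance (∑ q, X q) μ / (k - Fintype.card Q * t) ^ 2) :=
        meas_ge_le_variance_div_sq hsum (sub_pos.mpr hk)
    _ ≤ _ := by gcongr

/-- Overestimation bound: for `z` pairwise independent uniform `[0,1]` random
variables, `ε ∈ (0,1/4)` and `k ≥ 9/ε²` with `k/((1+ε)z) ≤ 1`, the probability
that at least `k` of the variables are smaller than `k/((1+ε)z)` is at most `1/6`. -/
theorem prob_overestimate_le
    {Ω Q : Type*} [MeasurableSpace Ω] [Fintype Q]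
    (μ : Measure Ω) [IsProbabilityMeasure μ]
    (z : ℕ) (hz : 1 ≤ z) (hQ : Fintype.card Q = z)
    (U : Q → Ω → ℝ) (hmeas : ∀ q, Measurable (U q))
    (hunif : ∀ q, Measure.map (U q) μ = volume.restrict (Set.Icc (0 : ℝ) 1))
    (hpi : Pairwise fun q q' => IndepFun (U q) (U q') μ)
    (ε k : ℝ) (hε : ε ∈ Set.Ioo (0 : ℝ) (1 / 4)) (hk : 9 / ε ^ 2 ≤ k)
    (hk1 : k / ((1 + ε) * z) ≤ 1) :
    μ {ω | k ≤ (Nat.card {q : Q // U q ω < k / ((1 + ε) * (z : ℝ))} : ℝ)} ≤ 1 / 6 := by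
  obtain ⟨hε0, hε1⟩ := hε
  have hz0 : (0 : ℝ) < z := by exact_mod_cast hz
  have hk0 : 0 < k := lt_of_lt_of_le (by positivity) hk
  have hmean : (Fintype.card Q : ℝ) * (k / ((1 + ε) * z)) = k / (1 + ε) := by
    rw [hQ]
    field_simp
  have hlt : k / (1 + ε) < k := div_lt_self hk0 (by linarith)
  refine (prob_le_card_uniform_lt_le μ U hmeas hunif hpi (by positivity) hk1
    (hmean ▸ hlt)).trans ?_
  rw [hmean]
  have hbound : k / (1 + ε) / (k - k / (1 + ε)) ^ 2 ≤ 1 / 6 := by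
    have hkε : 9 ≤ k * ε ^ 2 := (div_le_iff₀ (by positivity)).mp hk
    have heq : k / (1 + ε) / (k - k / (1 + ε)) ^ 2 = (1 + ε) / (k * ε ^ 2) := by
      have hdiff : k - k / (1 + ε) = k * ε / (1 + ε) := by
        field_simp
        ring
      rw [hdiff]
      field_simp
    rw [heq, div_le_iff₀ (by positivity)]
    linarith
  refine (ENNReal.ofReal_le_ofReal hbound).trans_eq ?_
  rw [ENNReal.ofReal_div_of_pos (by norm_num)]
  simp
end

section
/- Let Q be a finite index set with |Q| = z and let (U_q)_{q∈Q} be pairwise independent random variables, each uniformly distributed on [0,1]. Let ε ∈ (0, 1/4), let k be a positive integer with k ≥ 9/ε², and suppose z > k². Let v denote the kth smallest value among (U_q)_{q∈Q}, and define the estimator z̃ = k/v. Then Pr[(1−ε)z < z̃ < (1+ε)z] ≥ 2/3. -/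
open MeasureTheory ProbabilityTheory

/-- Chebyshev's inequality for the number of members of a pairwise independent family that fall
into a set which each of them hits with probability `p`. -/
theorem measure_abs_count_sub_ge_le
    {Ω Q α : Type*} [MeasurableSpace Ω] [MeasurableSpace α] [Fintype Q]
    (μ : Measure Ω) [IsProbabilityMeasure μ]
    (U : Q → Ω → α) (hmeas : ∀ q, Measurable (U q))
    (hpi : Pairwise fun q q' => IndepFun (U q) (U q') μ)
    {S : Set α} (hS : MeasurableSet S) {p : ℝ} (hp : ∀ q, μ.real (U q ⁻¹' S) = p)
    {c : ℝ} (hc : 0 < c) :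
    μ {ω | c ≤ |(Nat.card {q // U q ω ∈ S} : ℝ) - Fintype.card Q * p|} ≤
      ENNReal.ofReal (Fintype.card Q * p / c ^ 2) := by
  classical
  set f : α → ℝ := S.indicator 1 with hf
  have hfm : Measurable f := measurable_one.indicator hS
  set Y : Q → Ω → ℝ := fun q => f ∘ U q with hY
  have hYm : ∀ q, Measurable (Y q) := fun q => hfm.comp (hmeas q)
  have hYind : ∀ q, Y q = (U q ⁻¹' S).indicator 1 := fun q => by
    ext ω
    simp [hY, hf, Set.indicator]
  have hYL : ∀ q, MemLp (Y q) 2 μ := fun q => by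
    rw [hYind]
    exact memLp_indicator_const 2 (hmeas q hS) (1 : ℝ) (Or.inr (measure_ne_top _ _))
  have hYE : ∀ q, μ[Y q] = p := fun q => by
    rw [hYind, integral_indicator_one (hmeas q hS), hp]
  have hYV : ∀ q, variance (Y q) μ ≤ p := fun q => by
    refine (variance_le_expectation_sq (hYm q).aestronglyMeasurable).trans_eq ?_
    rw [← hYE q]
    congr 1
    ext ω
    by_cases h : ω ∈ U q ⁻¹' S <;> simp [hYind, h]
  have hcount : ∀ ω, (∑ q, Y q) ω = (Nat.card {q // U q ω ∈ S} : ℝ) := fun ω => by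
    simp [hY, hf, Set.indicator, Finset.sum_apply, Fintype.card_subtype]
  have hE : μ[∑ q, Y q] = Fintype.card Q * p := by
    simp only [Finset.sum_apply]
    rw [integral_finsetSum _ fun q _ => (hYL q).integrable one_le_two]
    simp [hYE]
  have hV : variance (∑ q, Y q) μ ≤ Fintype.card Q * p := by
    rw [IndepFun.variance_sum (fun q _ => hYL q)
      fun q _ q' _ hqq => (hpi hqq).comp hfm hfm]
    refine (Finset.sum_le_sum fun q _ => hYV q).trans_eq ?_
    simp
  have h := meas_ge_le_variance_div_sq (memLp_finsetSum' Finset.univ fun q _ => hYL q) hc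
  rw [hE] at h
  simp only [hcount] at h
  refine h.trans (ENNReal.ofReal_le_ofReal ?_)
  gcongr

/-- If fewer than `k` values are at most `a`, the `k`th smallest value exceeds `a`. -/
theorem lt_kth_smallest_of_card_lt {Q : Type*} [Fintype Q] {x : Q → ℝ} {k : ℕ} {a : ℝ}
    (hkQ : k ≤ Fintype.card Q) (h : Nat.card {q // x q ≤ a} < k) :
    a < sInf {t : ℝ | k ≤ Nat.card {q // x q ≤ t}} := by
  classical
  have hne : (Finset.univ.filter fun q => a < x q).Nonempty := by
    by_contra! hempty
    have hall : ∀ q, x q ≤ a := by simpa [Finset.filter_eq_empty_iff] using hempty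
    simp only [hall, Nat.card_eq_fintype_card] at h
    simp at h
    omega
  obtain ⟨q₀, hq₀, hmin⟩ := Finset.exists_min_image _ x hne
  have hQ : Nonempty Q := ⟨q₀⟩
  obtain ⟨q₁, -, hmax⟩ := Finset.exists_max_image Finset.univ x Finset.univ_nonempty
  refine (Finset.mem_filter.mp hq₀).2.trans_le (le_csInf ⟨x q₁, ?_⟩ fun t ht => ?_)
  · have hall : ∀ q, x q ≤ x q₁ := fun q => hmax q (Finset.mem_univ q)
    simpa [hall] using hkQ
  · by_contra! hlt
    refine absurd (h.trans_le ht) (not_lt.mpr ?_)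
    refine Nat.card_mono (Set.toFinite {q | x q ≤ a}) fun q (hq : x q ≤ t) => ?_
    by_contra hle
    have hqa : a < x q := not_le.mp hle
    have := hmin q (by simpa using hqa)
    linarith

/-- If at least `k` values are below `b`, so is the `k`th smallest value. -/
theorem kth_smallest_lt_of_le_card {Q : Type*} [Fintype Q] {x : Q → ℝ} {k : ℕ} {b : ℝ}
    (hk : 0 < k) (h : k ≤ Nat.card {q // x q < b}) :
    sInf {t : ℝ | k ≤ Nat.card {q // x q ≤ t}} < b := by
  classical
  have hne : (Finset.univ.filter fun q => x q < b).Nonempty := by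
    obtain ⟨⟨q, hq⟩⟩ := (Nat.card_pos_iff.mp (hk.trans_le h)).1
    exact ⟨q, by simpa using hq⟩
  obtain ⟨q₀, hq₀, hmax⟩ := Finset.exists_max_image _ x hne
  have hQ : Nonempty Q := ⟨q₀⟩
  obtain ⟨q₁, -, hmin⟩ := Finset.exists_min_image Finset.univ x Finset.univ_nonempty
  refine (csInf_le ⟨x q₁, fun t ht => ?_⟩ ?_).trans_lt (Finset.mem_filter.mp hq₀).2
  · obtain ⟨⟨q, hq⟩⟩ := (Nat.card_pos_iff.mp (hk.trans_le ht)).1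
    exact (hmin q (Finset.mem_univ q)).trans hq
  · exact h.trans (Nat.card_mono (Set.toFinite {q | x q ≤ x q₀}) fun q (hq : x q < b) =>
      hmax q (by simpa using hq))

/-- Error probability of the kth-smallest-value estimator, first case (`z > k²`):
for `z` pairwise independent uniform `[0,1]` random variables, `ε ∈ (0,1/4)` and a
positive integer `k ≥ 9/ε²`, if `v` denotes the `k`th smallest of the values then
the estimator `z̃ = k/v` satisfies `(1-ε)z < z̃ < (1+ε)z` with probability `≥ 2/3`. -/
theorem kth_smallest_estimator_accurate
    {Ω Q : Type*} [MeasurableSpace Ω] [Fintype Q]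
    (μ : Measure Ω) [IsProbabilityMeasure μ]
    (z : ℕ) (hQ : Fintype.card Q = z)
    (U : Q → Ω → ℝ) (hmeas : ∀ q, Measurable (U q))
    (hunif : ∀ q, Measure.map (U q) μ = volume.restrict (Set.Icc (0 : ℝ) 1))
    (hpi : Pairwise fun q q' => IndepFun (U q) (U q') μ)
    (ε : ℝ) (hε : ε ∈ Set.Ioo (0 : ℝ) (1 / 4))
    (k : ℕ) (hkpos : 0 < k) (hk : 9 / ε ^ 2 ≤ (k : ℝ)) (hzk : k ^ 2 < z)
    (v : Ω → ℝ)
    (hv : ∀ ω, v ω = sInf {t : ℝ | k ≤ Nat.card {q : Q // U q ω ≤ t}})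
    (ztilde : Ω → ℝ) (hzt : ∀ ω, ztilde ω = (k : ℝ) / v ω) :
    (2 / 3 : ENNReal) ≤
      μ {ω | (1 - ε) * (z : ℝ) < ztilde ω ∧ ztilde ω < (1 + ε) * (z : ℝ)} := by
  obtain ⟨hε0, hε1⟩ := hε
  have hk0 : (0 : ℝ) < k := by exact_mod_cast hkpos
  have hkε : 9 ≤ k * ε ^ 2 := by rwa [div_le_iff₀ (by positivity)] at hk
  have hk9 : (9 : ℝ) ≤ k := by nlinarith
  have hzkR : (k : ℝ) ^ 2 < z := by exact_mod_cast hzk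
  have hz0 : (0 : ℝ) < z := by nlinarith
  have hm : (0 : ℝ) < 1 - ε := by linarith
  have hkQ : k ≤ Fintype.card Q := by nlinarith
  set a : ℝ := k / ((1 + ε) * z) with ha
  set b : ℝ := k / ((1 - ε) * z) with hb
  have ha0 : 0 < a := by positivity
  have hb0 : 0 < b := by positivity
  have hb1 : b ≤ 1 := by
    rw [hb, div_le_one (by positivity)]
    nlinarith
  have ha1 : a ≤ 1 := by
    rw [ha, div_le_one (by positivity)]
    nlinarith
  have hprob : ∀ {S : Set ℝ}, MeasurableSet S → ∀ q,
      μ.real (U q ⁻¹' S) = volume.real (S ∩ Set.Icc (0 : ℝ) 1) := fun {S} hS q => by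
    rw [← map_measureReal_apply (hmeas q) hS, hunif q, measureReal_restrict_apply hS]
  have hpa : ∀ q, μ.real (U q ⁻¹' Set.Iic a) = a := fun q => by
    have hset : Set.Iic a ∩ Set.Icc (0 : ℝ) 1 = Set.Icc 0 a := by
      ext t
      simp only [Set.mem_inter_iff, Set.mem_Iic, Set.mem_Icc]
      grind
    rw [hprob measurableSet_Iic, hset, Real.volume_real_Icc_of_le ha0.le, sub_zero]
  have hpb : ∀ q, μ.real (U q ⁻¹' Set.Iio b) = b := fun q => by
    have hset : Set.Iio b ∩ Set.Icc (0 : ℝ) 1 = Set.Ico 0 b := by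
      ext t
      simp only [Set.mem_inter_iff, Set.mem_Iio, Set.mem_Icc, Set.mem_Ico]
      grind
    rw [hprob measurableSet_Iio, hset, Real.volume_real_Ico_of_le hb0.le, sub_zero]
  have hza : z * a = k / (1 + ε) := by rw [ha]; field_simp
  have hzb : z * b = k / (1 - ε) := by rw [hb]; field_simp
  have hA := measure_abs_count_sub_ge_le μ U hmeas hpi measurableSet_Iic hpa
    (c := k * ε / (1 + ε)) (by positivity)
  have hB := measure_abs_count_sub_ge_le μ U hmeas hpi measurableSet_Iio hpb
    (c := k * ε / (1 - ε)) (by positivity)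
  rw [hQ, hza] at hA
  rw [hQ, hzb] at hB
  set A := {ω | k * ε / (1 + ε) ≤ |(Nat.card {q // U q ω ∈ Set.Iic a} : ℝ) - k / (1 + ε)|}
  set B := {ω | k * ε / (1 - ε) ≤ |(Nat.card {q // U q ω ∈ Set.Iio b} : ℝ) - k / (1 - ε)|}
  set G := {ω | (1 - ε) * (z : ℝ) < ztilde ω ∧ ztilde ω < (1 + ε) * (z : ℝ)}
  have hcover : Set.univ ⊆ G ∪ (A ∪ B) := fun ω _ => by
    by_contra hω
    simp only [Set.mem_union, not_or] at hω
    obtain ⟨hωG, hωA, hωB⟩ := hω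
    have hAlt := (abs_lt.mp (not_le.mp (Set.notMem_ofPred_iff.mp hωA))).2
    have hBlt := (abs_lt.mp (not_le.mp (Set.notMem_ofPred_iff.mp hωB))).1
    have hkA : (k : ℝ) = k * ε / (1 + ε) + k / (1 + ε) := by field_simp; ring
    have hkB : (k : ℝ) = -(k * ε / (1 - ε)) + k / (1 - ε) := by field_simp; ring
    have hNa : Nat.card {q // U q ω ≤ a} < k := by
      have : (Nat.card {q // U q ω ∈ Set.Iic a} : ℝ) < k := by linarith
      exact_mod_cast this
    have hNb : k ≤ Nat.card {q // U q ω < b} := by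
      have : (k : ℝ) < Nat.card {q // U q ω ∈ Set.Iio b} := by linarith
      exact_mod_cast this.le
    have hav : a < v ω := hv ω ▸ lt_kth_smallest_of_card_lt hkQ hNa
    have hvb : v ω < b := hv ω ▸ kth_smallest_lt_of_le_card hkpos hNb
    have hv0 : 0 < v ω := ha0.trans hav
    refine hωG ⟨?_, ?_⟩
    · rw [hzt, lt_div_iff₀ hv0, mul_comm, ← lt_div_iff₀ (by positivity)]
      exact hvb
    · rw [hzt, div_lt_iff₀ hv0, mul_comm, ← div_lt_iff₀ (by positivity)]
      exact hav
  have hAB : μ (A ∪ B) ≤ ENNReal.ofReal (1 / 3) := by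
    refine (measure_union_le A B).trans ((add_le_add hA hB).trans ?_)
    rw [← ENNReal.ofReal_add (by positivity) (by positivity)]
    refine ENNReal.ofReal_le_ofReal ?_
    have hsum : k / (1 + ε) / (k * ε / (1 + ε)) ^ 2 + k / (1 - ε) / (k * ε / (1 - ε)) ^ 2
        = 2 / (k * ε ^ 2) := by
      field_simp
      ring
    rw [hsum, div_le_div_iff₀ (by positivity) (by norm_num)]
    linarith
  have hone : 1 ≤ μ G + ENNReal.ofReal (1 / 3) := by
    calc (1 : ENNReal) = μ Set.univ := measure_univ.symm
      _ ≤ μ (G ∪ (A ∪ B)) := measure_mono hcover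
      _ ≤ μ G + μ (A ∪ B) := measure_union_le _ _
      _ ≤ μ G + ENNReal.ofReal (1 / 3) := by gcongr
  have h23 : (2 / 3 : ENNReal) = 1 - ENNReal.ofReal (1 / 3) := by
    rw [← ENNReal.ofReal_one, ← ENNReal.ofReal_sub _ (by norm_num)]
    norm_num [ENNReal.ofReal_div_of_pos]
  rw [h23]
  exact tsub_le_iff_right.mpr hone
end

section
/- Let Q be a finite index set with |Q| = z and let (U_q)_{q∈Q} be pairwise independent random variables, each uniformly distributed on [0,1]. Let ε ∈ (0, 1/4), let k be a positive integer with k ≥ 9/ε², and suppose z ≤ k². Then the probability that at least k of the variables U_q take a value at most 1/((1+ε)k) is at most 1/6. (Consequently, with probability at least 5/6 the kth smallest value v, if it exists, satisfies k/v < (1+ε)k², so the estimator does not exceed (1+ε)k².) -/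
open MeasureTheory ProbabilityTheory

/-- Chebyshev's inequality for the number of members of a pairwise independent family that land
in a given measurable set, each of them with probability `p`. -/
theorem measure_le_natCard_of_pairwise_indepFun
    {Ω Q E : Type*} [MeasurableSpace Ω] [MeasurableSpace E] [Fintype Q]
    (μ : Measure Ω) [IsProbabilityMeasure μ] {U : Q → Ω → E} (hmeas : ∀ q, Measurable (U q))
    (hpi : Pairwise fun q q' => IndepFun (U q) (U q') μ)
    {s : Set E} (hs : MeasurableSet s) {p : ℝ} (hp : ∀ q, μ.real (U q ⁻¹' s) = p)
    {a : ℝ} (ha : Fintype.card Q * p < a) :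
    μ {ω | a ≤ (Nat.card {q : Q // U q ω ∈ s} : ℝ)} ≤
      ENNReal.ofReal (Fintype.card Q * p / (a - Fintype.card Q * p) ^ 2) := by
  classical
  set X : Q → Ω → ℝ := fun q => (U q ⁻¹' s).indicator 1 with hX
  have hset (q) : MeasurableSet (U q ⁻¹' s) := hmeas q hs
  have hLp (q) : MemLp (X q) 2 μ :=
    memLp_indicator_const 2 (hset q) (1 : ℝ) (Or.inr (measure_ne_top _ _))
  have hmean (q) : μ[X q] = p := by rw [hX, integral_indicator_one (hset q), hp]
  have hind : Pairwise fun q q' => IndepFun (X q) (X q') μ := fun q q' h =>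
    (hpi h).comp (φ := s.indicator (1 : E → ℝ)) (ψ := s.indicator (1 : E → ℝ))
      (measurable_one.indicator hs) (measurable_one.indicator hs)
  have hvar (q) : Var[X q; μ] ≤ p := by
    refine (variance_le_expectation_sq (hLp q).1).trans_eq ?_
    rw [← hmean q]
    congr 1
    ext ω
    by_cases h : U q ω ∈ s <;> simp [hX, h]
  have hcard (ω) : (Nat.card {q : Q // U q ω ∈ s} : ℝ) = (∑ q, X q) ω := by
    simp [hX, Set.indicator_apply, Fintype.card_subtype]
  have hmeanS : μ[∑ q, X q] = Fintype.card Q * p := by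
    simp_rw [Finset.sum_apply]
    rw [integral_finsetSum _ fun q _ => (hLp q).integrable one_le_two]
    simp [hmean]
  have hvarS : Var[∑ q, X q; μ] ≤ Fintype.card Q * p := by
    rw [IndepFun.variance_sum (fun q _ => hLp q) fun q _ q' _ h => hind h]
    exact (Finset.sum_le_sum fun q _ => hvar q).trans_eq (by simp)
  calc μ {ω | a ≤ (Nat.card {q : Q // U q ω ∈ s} : ℝ)}
      ≤ μ {ω | a - Fintype.card Q * p ≤ |(∑ q, X q) ω - μ[∑ q, X q]|} := by
        refine measure_mono fun ω hω => ?_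
        simp only [Set.mem_ofPred_eq, hcard, hmeanS] at hω ⊢
        exact (sub_le_sub_right hω _).trans (le_abs_self _)
    _ ≤ ENNReal.ofReal (Var[∑ q, X q; μ] / (a - Fintype.card Q * p) ^ 2) :=
        meas_ge_le_variance_div_sq (memLp_finsetSum' _ fun q _ => hLp q) (sub_pos.2 ha)
    _ ≤ _ := by gcongr


/-- Error probability of the kth-smallest-value estimator, second case (`z ≤ k²`):
for `z` pairwise independent uniform `[0,1]` random variables, `ε ∈ (0,1/4)` and a
positive integer `k ≥ 9/ε²`, the probability that at least `k` of the variables are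
at most `1/((1+ε)k)` is at most `1/6`. -/
theorem kth_smallest_estimator_small_case
    {Ω Q : Type*} [MeasurableSpace Ω] [Fintype Q]
    (μ : Measure Ω) [IsProbabilityMeasure μ]
    (z : ℕ) (hQ : Fintype.card Q = z)
    (U : Q → Ω → ℝ) (hmeas : ∀ q, Measurable (U q))
    (hunif : ∀ q, Measure.map (U q) μ = volume.restrict (Set.Icc (0 : ℝ) 1))
    (hpi : Pairwise fun q q' => IndepFun (U q) (U q') μ)
    (ε : ℝ) (hε : ε ∈ Set.Ioo (0 : ℝ) (1 / 4))
    (k : ℕ) (hkpos : 0 < k) (hk : 9 / ε ^ 2 ≤ (k : ℝ)) (hzk : z ≤ k ^ 2) :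
    μ {ω | (k : ℝ) ≤ (Nat.card {q : Q // U q ω ≤ 1 / ((1 + ε) * (k : ℝ))} : ℝ)} ≤
      1 / 6 := by
  obtain ⟨hε0, hε1⟩ := hε
  have hk1 : (1 : ℝ) ≤ k := by exact_mod_cast hkpos
  set t : ℝ := 1 / ((1 + ε) * k) with ht
  have ht0 : 0 < t := by positivity
  have ht1 : t ≤ 1 := by
    rw [ht, div_le_one (by positivity)]
    nlinarith
  have hprob (q) : μ.real (U q ⁻¹' Set.Iic t) = t := by
    rw [measureReal_def, ← Measure.map_apply (hmeas q) measurableSet_Iic, hunif,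
      Measure.restrict_apply measurableSet_Iic]
    have : Set.Iic t ∩ Set.Icc (0 : ℝ) 1 = Set.Icc 0 t := by
      ext x
      simp only [Set.mem_inter_iff, Set.mem_Iic, Set.mem_Icc]
      grind
    simp [this, ht0.le]
  have hz : (Fintype.card Q : ℝ) ≤ k ^ 2 := by
    rw [hQ]
    exact_mod_cast hzk
  have hm : Fintype.card Q * t ≤ k / (1 + ε) := by
    calc Fintype.card Q * t ≤ k ^ 2 * t := by gcongr
      _ = k / (1 + ε) := by rw [ht]; field_simp
  have hgap : k - k / (1 + ε) = k * ε / (1 + ε) := by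
    field_simp
    ring
  have hgap0 : 0 < k * ε / (1 + ε) := by positivity
  refine (measure_le_natCard_of_pairwise_indepFun μ hmeas hpi measurableSet_Iic hprob
    (a := k) (by linarith)).trans ?_
  have hkε : 9 ≤ k * ε ^ 2 := (div_le_iff₀ (by positivity)).1 hk
  have hbound : Fintype.card Q * t / (k - Fintype.card Q * t) ^ 2 ≤ 1 / 6 := by
    calc Fintype.card Q * t / (k - Fintype.card Q * t) ^ 2
        ≤ k / (1 + ε) / (k * ε / (1 + ε)) ^ 2 := by
          gcongr
          linarith
      _ = (1 + ε) / (k * ε ^ 2) := by field_simp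
      _ ≤ 1 / 6 := by
          rw [div_le_div_iff₀ (by positivity) (by norm_num)]
          linarith
  refine (ENNReal.ofReal_le_ofReal hbound).trans_eq ?_
  rw [ENNReal.ofReal_div_of_pos (by norm_num)]
  norm_num
end
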